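/- Fix k ≥ 2 and evaluate the Jacobian matrix M_k of the type-refined system at z = 1/4. Let M_k^★ and M_k^• be its principal submatrices indexed by 𝒯_k^★ and 𝒯_k^• = 𝒯_k \ 𝒯_k^★ respectively. Then SR(M_k^•(1/4)) < SR(M_k^★(1/4)) = SR(M_k(1/4)) = 1, where SR denotes the spectral radius. -/

import Mathlib

open FirstOrder Filter Asymptotics Topology

namespace Av231

/-- Relation symbols of the theory of two orders: two binary relations `<_P` and `<_V`. -/
inductive TwoRel : ℕ → Type
  | lp : TwoRel 2
  | lv : TwoRel 2

/-- The first-order language with two binary relation symbols `<_P` and `<_V`. -/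
def L : Language := ⟨fun _ => Empty, TwoRel⟩

/-- The `L`-structure on `Fin n` associated with a permutation `σ` of `{1,…,n}`:
`i <_P j` iff `i < j` and `i <_V j` iff `σ i < σ j`. -/
def pStruct {n : ℕ} (σ : Equiv.Perm (Fin n)) : L.Structure (Fin n) where
  funMap := fun f _ => nomatch f
  RelMap := fun r x =>
    match r with
    | .lp => x 0 < x 1
    | .lv => σ (x 0) < σ (x 1)

/-- A permutation satisfies a first-order sentence. -/
def Sat {n : ℕ} (σ : Equiv.Perm (Fin n)) (ψ : L.Sentence) : Prop :=
  @Language.Sentence.Realize L (Fin n) (pStruct σ) ψ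

/-- The quantifier depth of a first-order formula. -/
def qd {L' : Language} {α : Type*} : ∀ {n : ℕ}, L'.BoundedFormula α n → ℕ
  | _, .falsum => 0
  | _, .equal _ _ => 0
  | _, .rel _ _ => 0
  | _, .imp f g => max (qd f) (qd g)
  | _, .all f => qd f + 1

/-- A permutation avoids the pattern `231`. -/
def Avoids {n : ℕ} (σ : Equiv.Perm (Fin n)) : Prop :=
  ¬ ∃ i j k : Fin n, i < j ∧ j < k ∧ σ k < σ i ∧ σ i < σ j

/-- The number of `231`-avoiding permutations of size `n` satisfying `ψ`. -/
noncomputable def avN (n : ℕ) (ψ : L.Sentence) : ℕ :=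
  Nat.card {σ : Equiv.Perm (Fin n) // Avoids σ ∧ Sat σ ψ}

/-- The probability that a uniform random `231`-avoiding permutation of size `n`
satisfies `ψ` (the number of `231`-avoiding permutations of size `n` is `catalan n`). -/
noncomputable def prob (n : ℕ) (ψ : L.Sentence) : ℝ :=
  (avN n ψ : ℝ) / (catalan n : ℝ)

/-- Permutations of arbitrary finite size. -/
abbrev FinPerm := Σ n : ℕ, Equiv.Perm (Fin n)

def AvoidsF (p : FinPerm) : Prop := Avoids p.2

/-- Direct sum of permutations. -/
def dsum {a b : ℕ} (σ : Equiv.Perm (Fin a)) (τ : Equiv.Perm (Fin b)) :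
    Equiv.Perm (Fin (a + b)) :=
  finSumFinEquiv.permCongr (Equiv.sumCongr σ τ)

/-- Skew sum of permutations. -/
def ssum {a b : ℕ} (σ : Equiv.Perm (Fin a)) (τ : Equiv.Perm (Fin b)) :
    Equiv.Perm (Fin (a + b)) :=
  finSumFinEquiv.symm.trans ((Equiv.sumCongr σ τ).trans
    ((Equiv.sumComm (Fin a) (Fin b)).trans (finSumFinEquiv.trans (finCongr (Nat.add_comm b a)))))

/-- The operation `(τ, π) ↦ τ ⊕ (1 ⊖ π)` on permutations of arbitrary sizes. -/
def glue (τ π : FinPerm) : FinPerm :=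
  ⟨τ.1 + (1 + π.1), dsum τ.2 (ssum (1 : Equiv.Perm (Fin 1)) π.2)⟩

/-- Two permutations are `k`-equivalent when they satisfy the same first-order sentences
of quantifier depth at most `k`. -/
def kEquiv (k : ℕ) (p q : FinPerm) : Prop :=
  ∀ ψ : L.Sentence, qd ψ ≤ k → (Sat p.2 ψ ↔ Sat q.2 ψ)

end Av231

/-- `k`-equivalence as a setoid on finite permutations. -/
def kSetoid (k : ℕ) : Setoid Av231.FinPerm :=
  ⟨Av231.kEquiv k,
    ⟨fun _ _ _ => Iff.rfl, fun h ψ hψ => (h ψ hψ).symm,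
      fun h h' ψ hψ => (h ψ hψ).trans (h' ψ hψ)⟩⟩

namespace Av231

/-- Logical types of order `k`: equivalence classes of `≡ₖ`. -/
def QT (k : ℕ) := Quotient (kSetoid k)

/-- The logical type of order `k` of a permutation. -/
def typeOf (k : ℕ) (p : FinPerm) : QT k := Quotient.mk (kSetoid k) p

/-- A type is realized when some `231`-avoiding permutation has this type;
`𝒯ₖ` consists of the realized types. -/
def Realized (k : ℕ) (t : QT k) : Prop := ∃ p : FinPerm, AvoidsF p ∧ typeOf k p = t

/-- The number of `231`-avoiding permutations of size `n` whose logical type of order `k`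
is `t`, i.e. the `n`-th coefficient of the generating series `C_t`. -/
noncomputable def cnt (k : ℕ) (t : QT k) (n : ℕ) : ℕ :=
  Nat.card {σ : Equiv.Perm (Fin n) // Avoids σ ∧ typeOf k ⟨n, σ⟩ = t}

/-- The type of the empty permutation. -/
def emptyType (k : ℕ) : QT k := typeOf k ⟨0, 1⟩

/-- `H_k(t₁,t₂)`: the type of `τ ⊕ (1 ⊖ π)` where `τ, π` are representatives
of `t₁, t₂` respectively. -/
noncomputable def Hfun (k : ℕ) (t₁ t₂ : QT k) : QT k :=
  typeOf k (glue (Quotient.out t₁) (Quotient.out t₂))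

/-- The edge relation `u → t` of the dependency graph `G_k`:
`∂F_t/∂C_u ≠ 0`, i.e. some `v ∈ 𝒯ₖ` satisfies `H_k(u,v) = t` or `H_k(v,u) = t`. -/
def Edge (k : ℕ) (u t : QT k) : Prop :=
  ∃ v : QT k, Realized k v ∧ (Hfun k u v = t ∨ Hfun k v u = t)

/-- The set `𝒯ₖ` of types realized by `231`-avoiding permutations, as a type. -/
def Tk (k : ℕ) := {t : QT k // Realized k t}

/-- The edge relation of `G_k` restricted to `𝒯ₖ`. -/
def EdgeT (k : ℕ) (u t : Tk k) : Prop := Edge k u.1 t.1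

/-- `S` is a terminal strongly connected component of the dependency graph `G_k`:
it is nonempty, any vertex of `S` reaches any other, and no edge leaves `S`
(this forces maximality, hence being an SCC). -/
def IsTermSCC (k : ℕ) (S : Set (Tk k)) : Prop :=
  S.Nonempty ∧ (∀ u ∈ S, ∀ v ∈ S, Relation.ReflTransGen (EdgeT k) u v) ∧
    (∀ u ∈ S, ∀ v : Tk k, EdgeT k u v → v ∈ S)

/-- A sequence of coefficients is periodic when, for some `d ≥ 2` and `r`,
it vanishes outside `dℤ + r`. -/
def SeqPeriodic (a : ℕ → ℝ) : Prop :=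
  ∃ d : ℕ, 2 ≤ d ∧ ∃ r : ℕ, ∀ n : ℕ, n % d ≠ r % d → a n = 0

/-- The generating series `C_t` of `231`-avoiding permutations of type `t`,
evaluated at a complex number `z`. -/
noncomputable def Ct (k : ℕ) (t : QT k) (z : ℂ) : ℂ :=
  ∑' n : ℕ, (cnt k t n : ℂ) * z ^ n

/-- The Catalan generating function. -/
noncomputable def catGF (z : ℂ) : ℂ := ∑' n : ℕ, (catalan n : ℂ) * z ^ n

/-- The entry `M_k(z)_{t,u} = ∂F_t/∂C_u (z; C_v(z), v ∈ 𝒯ₖ)` of the Jacobian matrix of the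
type-refined system. -/
noncomputable def Mmat (k : ℕ) (z : ℂ) (t u : QT k) : ℂ :=
  z * ((∑' v : {v : QT k // Realized k v ∧ Hfun k u v = t}, Ct k v.1 z) +
       (∑' v : {v : QT k // Realized k v ∧ Hfun k v u = t}, Ct k v.1 z))

/-- `lam` is an eigenvalue of the (possibly infinite) matrix `A`, witnessed by a finitely
supported eigenvector. For finite index types this is the usual notion of eigenvalue. -/
def IsEig {α : Type*} (A : α → α → ℂ) (lam : ℂ) : Prop :=
  ∃ v : α →₀ ℂ, v ≠ 0 ∧ ∀ x : α, ∑ y ∈ v.support, A x y * v y = lam * v x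


/-! ### Rank types and first-order equivalence -/

/-- The order relations holding between the entries of a tuple of elements of `p`. -/
def atoms {m : ℕ} (p : FinPerm) (a : Fin m → Fin p.1) : Fin m → Fin m → Prop × Prop :=
  fun i j => (a i < a j, p.2 (a i) < p.2 (a j))

/-- Ehrenfeucht–Fraïssé types of rank `k` of `m`-tuples. -/
def RankType : ℕ → ℕ → Type
  | 0, m => Fin m → Fin m → Prop × Prop
  | k + 1, m => (Fin m → Fin m → Prop × Prop) × Set (RankType k (m + 1))

instance finite_rankType (k : ℕ) : ∀ m, Finite (RankType k m) := by
  induction k with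
  | zero => intro m; unfold RankType; infer_instance
  | succ k ih => intro m; have := ih (m + 1); unfold RankType; infer_instance

/-- The rank `k` type of a tuple of elements of a permutation: it records the order relations
in the tuple and, if `k > 0`, the set of types of rank `k - 1` of its one-point extensions. -/
def rankType : (k : ℕ) → {m : ℕ} → (p : FinPerm) → (Fin m → Fin p.1) → RankType k m
  | 0, _, p, a => atoms p a
  | k + 1, _, p, a => (atoms p a, Set.range fun x => rankType k p (Fin.snoc a x))

theorem rankType_succ_eq_iff {k m : ℕ} {p q : FinPerm} {a : Fin m → Fin p.1}
    {b : Fin m → Fin q.1} :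
    rankType (k + 1) p a = rankType (k + 1) q b ↔ atoms p a = atoms q b ∧
      (∀ x, ∃ y, rankType k p (Fin.snoc a x) = rankType k q (Fin.snoc b y)) ∧
      (∀ y, ∃ x, rankType k p (Fin.snoc a x) = rankType k q (Fin.snoc b y)) := by
  refine Prod.ext_iff.trans (and_congr Iff.rfl ?_)
  change (Set.range fun x => rankType k p (Fin.snoc a x)) =
    (Set.range fun x => rankType k q (Fin.snoc b x)) ↔ _
  rw [Set.Subset.antisymm_iff, Set.range_subset_iff, Set.range_subset_iff]
  simp only [Set.mem_range, eq_comm]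

theorem atoms_eq_of_rankType_eq {k m : ℕ} {p q : FinPerm} {a : Fin m → Fin p.1}
    {b : Fin m → Fin q.1} (h : rankType k p a = rankType k q b) : atoms p a = atoms q b := by
  cases k with
  | zero => exact h
  | succ k => exact (rankType_succ_eq_iff.1 h).1

theorem rankType_eq_of_succ {k : ℕ} : ∀ {m : ℕ} {p q : FinPerm} {a : Fin m → Fin p.1}
    {b : Fin m → Fin q.1}, rankType (k + 1) p a = rankType (k + 1) q b →
    rankType k p a = rankType k q b := by
  induction k with
  | zero => intro m p q a b h; exact atoms_eq_of_rankType_eq h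
  | succ k ih =>
    intro m p q a b h
    obtain ⟨h₀, h₁, h₂⟩ := rankType_succ_eq_iff.1 h
    exact rankType_succ_eq_iff.2 ⟨h₀, fun x => (h₁ x).imp fun _ => ih,
      fun y => (h₂ y).imp fun _ => ih⟩

/-- A tuple of elements of a permutation satisfies a formula. -/
def Holds {m : ℕ} (p : FinPerm) (φ : L.BoundedFormula Empty m) (a : Fin m → Fin p.1) : Prop :=
  @Language.BoundedFormula.Realize L (Fin p.1) (pStruct p.2) Empty m φ default a

theorem exists_realize_term_eq {m : ℕ} (t : L.Term (Empty ⊕ Fin m)) :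
    ∃ i : Fin m, ∀ (p : FinPerm) (a : Fin m → Fin p.1),
      @Language.Term.realize L (Fin p.1) (pStruct p.2) _ (Sum.elim default a) t = a i := by
  cases t with
  | var x =>
    rcases x with x | i
    · exact x.elim
    · exact ⟨i, fun _ _ => rfl⟩
  | func f _ => exact nomatch f

theorem holds_iff_of_rankType_eq {m : ℕ} (φ : L.BoundedFormula Empty m) :
    ∀ {k : ℕ}, qd φ ≤ k → ∀ {p q : FinPerm} {a : Fin m → Fin p.1} {b : Fin m → Fin q.1},
      rankType k p a = rankType k q b → (Holds p φ a ↔ Holds q φ b) := by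
  induction φ with
  | falsum => intros; exact Iff.rfl
  | equal s t =>
    intro k _ p q a b h
    obtain ⟨i, hi⟩ := exists_realize_term_eq s
    obtain ⟨j, hj⟩ := exists_realize_term_eq t
    have h := atoms_eq_of_rankType_eq h
    have hij : (a i < a j) = (b i < b j) := congrArg Prod.fst (congrFun₂ h i j)
    have hji : (a j < a i) = (b j < b i) := congrArg Prod.fst (congrFun₂ h j i)
    simp only [Holds, Language.BoundedFormula.Realize, hi, hj]
    rw [le_antisymm_iff, le_antisymm_iff, ← not_lt, ← not_lt, ← not_lt, ← not_lt, hij, hji]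
  | rel R ts =>
    intro k _ p q a b h
    have h := atoms_eq_of_rankType_eq h
    cases R with
    | lp =>
      obtain ⟨i, hi⟩ := exists_realize_term_eq (ts 0)
      obtain ⟨j, hj⟩ := exists_realize_term_eq (ts 1)
      have hij : (a i < a j) = (b i < b j) := congrArg Prod.fst (congrFun₂ h i j)
      have e : ∀ (r : FinPerm) (c : Fin _ → Fin r.1),
          Holds r (.rel (TwoRel.lp : L.Relations 2) ts) c ↔ c i < c j :=
        fun r c => by rw [← hi r c, ← hj r c]; exact Iff.rfl
      exact (e p a).trans (hij ▸ (e q b).symm)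
    | lv =>
      obtain ⟨i, hi⟩ := exists_realize_term_eq (ts 0)
      obtain ⟨j, hj⟩ := exists_realize_term_eq (ts 1)
      have hij : (p.2 (a i) < p.2 (a j)) = (q.2 (b i) < q.2 (b j)) :=
        congrArg Prod.snd (congrFun₂ h i j)
      have e : ∀ (r : FinPerm) (c : Fin _ → Fin r.1),
          Holds r (.rel (TwoRel.lv : L.Relations 2) ts) c ↔ r.2 (c i) < r.2 (c j) :=
        fun r c => by rw [← hi r c, ← hj r c]; exact Iff.rfl
      exact (e p a).trans (hij ▸ (e q b).symm)
  | imp φ ψ ihφ ihψ =>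
    intro k hk p q a b h
    exact imp_congr (ihφ ((le_max_left _ _).trans hk) h) (ihψ ((le_max_right _ _).trans hk) h)
  | all φ ih =>
    intro k hk p q a b h
    obtain _ | k := k
    · exact absurd hk (Nat.not_succ_le_zero _)
    obtain ⟨-, h₁, h₂⟩ := rankType_succ_eq_iff.1 h
    have hk : qd φ ≤ k := Nat.le_of_succ_le_succ hk
    constructor
    · intro H y
      obtain ⟨x, hx⟩ := h₂ y
      exact (ih hk hx).1 (H x)
    · intro H x
      obtain ⟨y, hy⟩ := h₁ x
      exact (ih hk hy).2 (H y)

theorem exists_conj {ι : Type*} {k m : ℕ} (φ : ι → L.BoundedFormula Empty m)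
    (hφ : ∀ i, qd (φ i) ≤ k) (s : Finset ι) :
    ∃ ψ : L.BoundedFormula Empty m, qd ψ ≤ k ∧
      ∀ (p : FinPerm) (a : Fin m → Fin p.1), Holds p ψ a ↔ ∀ i ∈ s, Holds p (φ i) a := by
  classical
  induction s using Finset.induction_on with
  | empty => exact ⟨⊤, by simp [qd], fun p a => by simp [Holds]⟩
  | insert i s _ ih =>
    obtain ⟨ψ, hψ, h⟩ := ih
    refine ⟨φ i ⊓ ψ, ?_, fun p a => ?_⟩
    · change max (max (qd (φ i)) (max (qd ψ) 0)) 0 ≤ k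
      simp [hψ, hφ]
    · rw [Finset.forall_mem_insert, ← h]
      exact @Language.BoundedFormula.realize_inf L (Fin p.1) (pStruct p.2) _ _ _ _ _ _

theorem rankType_eq_of_holds {k : ℕ} : ∀ {m : ℕ} {p q : FinPerm} {a : Fin m → Fin p.1}
    {b : Fin m → Fin q.1},
    (∀ φ : L.BoundedFormula Empty m, qd φ ≤ k → (Holds p φ a ↔ Holds q φ b)) →
    rankType k p a = rankType k q b := by
  have hatoms : ∀ {k m : ℕ} {p q : FinPerm} {a : Fin m → Fin p.1} {b : Fin m → Fin q.1},
      (∀ φ : L.BoundedFormula Empty m, qd φ ≤ k → (Holds p φ a ↔ Holds q φ b)) →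
      atoms p a = atoms q b := by
    intro k m p q a b h
    funext i j
    exact Prod.ext
      (propext (h (.rel (TwoRel.lp : L.Relations 2) ![.var (.inr i), .var (.inr j)])
        (Nat.zero_le _)))
      (propext (h (.rel (TwoRel.lv : L.Relations 2) ![.var (.inr i), .var (.inr j)])
        (Nat.zero_le _)))
  induction k with
  | zero => exact hatoms
  | succ k ih =>
    have forth : ∀ {m : ℕ} {p q : FinPerm} {a : Fin m → Fin p.1} {b : Fin m → Fin q.1},
        (∀ φ : L.BoundedFormula Empty m, qd φ ≤ k + 1 → (Holds p φ a ↔ Holds q φ b)) →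
        ∀ x, ∃ y, rankType k p (Fin.snoc a x) = rankType k q (Fin.snoc b y) := by
      intro m p q a b h x
      by_contra! hne
      have sep : ∀ y, ∃ φ : L.BoundedFormula Empty (m + 1), qd φ ≤ k ∧
          Holds p φ (Fin.snoc a x) ∧ ¬ Holds q φ (Fin.snoc b y) := by
        intro y
        by_contra! hy
        refine hne y (ih fun φ hφ => ⟨hy φ hφ, fun hq => ?_⟩)
        by_contra hp
        exact hy φ.not ((max_le hφ (Nat.zero_le k)) : max (qd φ) 0 ≤ k) hp hq
      choose φ hφ hp hq using sep
      obtain ⟨ψ, hψ, H⟩ := exists_conj φ hφ Finset.univ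
      refine (h (ψ.not.all) ?_).2 (fun y hy => ?_) x ((H p _).2 fun y _ => hp y)
      · exact Nat.succ_le_succ ((max_le hψ (Nat.zero_le k)) : max (qd ψ) 0 ≤ k)
      · exact hq y ((H q _).1 hy y (Finset.mem_univ y))
    intro m p q a b h
    exact rankType_succ_eq_iff.2 ⟨hatoms h, forth h, fun y =>
      (forth (fun φ hφ => (h φ hφ).symm) y).imp fun _ => Eq.symm⟩

theorem kEquiv_iff_rankType_eq {k : ℕ} {p q : FinPerm} :
    kEquiv k p q ↔ rankType k (m := 0) p default = rankType k (m := 0) q default :=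
  ⟨fun h => rankType_eq_of_holds h, fun h ψ hψ => holds_iff_of_rankType_eq ψ hψ h⟩

theorem typeOf_eq_iff {k : ℕ} {p q : FinPerm} :
    typeOf k p = typeOf k q ↔ rankType k (m := 0) p default = rankType k (m := 0) q default :=
  Quotient.eq.trans kEquiv_iff_rankType_eq

instance finite_QT (k : ℕ) : Finite (QT k) := by
  refine Finite.of_injective
    (fun t : QT k => rankType k (m := 0) (Quotient.out t) default) fun s t h => ?_
  rw [← Quotient.out_eq s, ← Quotient.out_eq t]
  exact typeOf_eq_iff.2 h

instance finite_Tk (k : ℕ) : Finite (Tk k) := inferInstanceAs (Finite {t : QT k // Realized k t})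

/-! ### The gluing operation -/

/-- The three blocks of positions of `glue p q`. -/
def glueEmb (p q : FinPerm) (x : Fin p.1 ⊕ Fin 1 ⊕ Fin q.1) : Fin (glue p q).1 :=
  finSumFinEquiv (Sum.map id finSumFinEquiv x)

theorem glueEmb_surjective (p q : FinPerm) : Function.Surjective (glueEmb p q) :=
  finSumFinEquiv.surjective.comp
    (Function.surjective_id.sumMap finSumFinEquiv.surjective)

theorem glueEmb_left (p q : FinPerm) (i : Fin p.1) : (glueEmb p q (.inl i) : ℕ) = i := rfl

theorem glueEmb_mid (p q : FinPerm) (i : Fin 1) : (glueEmb p q (.inr (.inl i)) : ℕ) = p.1 := by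
  change p.1 + (i : ℕ) = p.1
  omega

theorem glueEmb_right (p q : FinPerm) (j : Fin q.1) :
    (glueEmb p q (.inr (.inr j)) : ℕ) = p.1 + (1 + j) := rfl

theorem glue_apply_glueEmb (p q : FinPerm) (x : Fin p.1 ⊕ Fin 1 ⊕ Fin q.1) :
    (glue p q).2 (glueEmb p q x) =
      finSumFinEquiv (Sum.map p.2 (ssum 1 q.2) (Sum.map id finSumFinEquiv x)) := by
  change finSumFinEquiv (Equiv.sumCongr p.2 (ssum 1 q.2)
    (finSumFinEquiv.symm (finSumFinEquiv (Sum.map id finSumFinEquiv x)))) = _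
  rw [Equiv.symm_apply_apply]
  rfl

theorem glue_apply_left (p q : FinPerm) (i : Fin p.1) :
    ((glue p q).2 (glueEmb p q (.inl i)) : ℕ) = p.2 i := by
  rw [glue_apply_glueEmb]
  rfl

theorem glue_apply_mid (p q : FinPerm) (i : Fin 1) :
    ((glue p q).2 (glueEmb p q (.inr (.inl i))) : ℕ) = p.1 + q.1 := by
  rw [glue_apply_glueEmb]
  simp [ssum]

theorem glue_apply_right (p q : FinPerm) (j : Fin q.1) :
    ((glue p q).2 (glueEmb p q (.inr (.inr j))) : ℕ) = p.1 + q.2 j := by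
  rw [glue_apply_glueEmb]
  simp [ssum]

theorem atoms_glue_eq {p p' q q' : FinPerm} {m m₁ m₂ : ℕ}
    {a : Fin m₁ → Fin p.1} {a' : Fin m₁ → Fin p'.1} {b : Fin m₂ → Fin q.1}
    {b' : Fin m₂ → Fin q'.1} (f : Fin m → Fin m₁ ⊕ Fin 1 ⊕ Fin m₂)
    (ha : atoms p a = atoms p' a') (hb : atoms q b = atoms q' b') :
    atoms (glue p q) (fun i => glueEmb p q (Sum.map a (Sum.map id b) (f i))) =
      atoms (glue p' q') (fun i => glueEmb p' q' (Sum.map a' (Sum.map id b') (f i))) := by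
  have ha₁ : ∀ i j, ((a i : ℕ) < a j) = ((a' i : ℕ) < a' j) :=
    fun i j => congrArg Prod.fst (congrFun₂ ha i j)
  have ha₂ : ∀ i j, ((p.2 (a i) : ℕ) < p.2 (a j)) = ((p'.2 (a' i) : ℕ) < p'.2 (a' j)) :=
    fun i j => congrArg Prod.snd (congrFun₂ ha i j)
  have hb₁ : ∀ i j, ((b i : ℕ) < b j) = ((b' i : ℕ) < b' j) :=
    fun i j => congrArg Prod.fst (congrFun₂ hb i j)
  have hb₂ : ∀ i j, ((q.2 (b i) : ℕ) < q.2 (b j)) = ((q'.2 (b' i) : ℕ) < q'.2 (b' j)) :=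
    fun i j => congrArg Prod.snd (congrFun₂ hb i j)
  funext i j
  refine Prod.ext ?_ ?_
  · simp only [atoms, Fin.lt_def]
    rcases f i with x | x | x <;> rcases f j with y | y | y <;>
      simp only [Sum.map_inl, Sum.map_inr, glueEmb_left, glueEmb_mid, glueEmb_right, id] <;>
      grind
  · simp only [atoms, Fin.lt_def]
    rcases f i with x | x | x <;> rcases f j with y | y | y <;>
      simp only [Sum.map_inl, Sum.map_inr, glue_apply_left, glue_apply_mid, glue_apply_right,
        id] <;>
      grind

theorem rankType_glue_eq {p p' q q' : FinPerm} (k : ℕ) : ∀ {m m₁ m₂ : ℕ}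
    {a : Fin m₁ → Fin p.1} {a' : Fin m₁ → Fin p'.1} {b : Fin m₂ → Fin q.1}
    {b' : Fin m₂ → Fin q'.1} (f : Fin m → Fin m₁ ⊕ Fin 1 ⊕ Fin m₂),
    rankType k p a = rankType k p' a' → rankType k q b = rankType k q' b' →
    rankType k (glue p q) (fun i => glueEmb p q (Sum.map a (Sum.map id b) (f i))) =
      rankType k (glue p' q') (fun i => glueEmb p' q' (Sum.map a' (Sum.map id b') (f i))) := by
  induction k with
  | zero => intro m m₁ m₂ a a' b b' f ha hb; exact atoms_glue_eq f ha hb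
  | succ k ih =>
    intro m m₁ m₂ a a' b b' f ha hb
    obtain ⟨ha₀, ha₁, ha₂⟩ := rankType_succ_eq_iff.1 ha
    obtain ⟨hb₀, hb₁, hb₂⟩ := rankType_succ_eq_iff.1 hb
    have left : ∀ {r s : FinPerm} (c : Fin m₁ → Fin r.1) (d : Fin m₂ → Fin s.1) (x : Fin r.1),
        (Fin.snoc (fun i => glueEmb r s (Sum.map c (Sum.map id d) (f i))) (glueEmb r s (.inl x)) :
          Fin (m + 1) → Fin (glue r s).1) = fun i => glueEmb r s
            (Sum.map (Fin.snoc c x : Fin (m₁ + 1) → Fin r.1) (Sum.map id d)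
              ((Fin.snoc (fun i => Sum.map Fin.castSucc id (f i)) (.inl (Fin.last m₁)) :
                Fin (m + 1) → Fin (m₁ + 1) ⊕ Fin 1 ⊕ Fin m₂) i)) := by
      intro r s c d x
      funext i
      refine Fin.lastCases (by simp) (fun i => ?_) i
      simp only [Fin.snoc_castSucc]
      rcases f i with y | y | y <;> simp
    have mid : ∀ {r s : FinPerm} (c : Fin m₁ → Fin r.1) (d : Fin m₂ → Fin s.1) (x : Fin 1),
        (Fin.snoc (fun i => glueEmb r s (Sum.map c (Sum.map id d) (f i)))
            (glueEmb r s (.inr (.inl x))) : Fin (m + 1) → Fin (glue r s).1) =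
          fun i => glueEmb r s (Sum.map c (Sum.map id d)
            ((Fin.snoc f (.inr (.inl x)) : Fin (m + 1) → Fin m₁ ⊕ Fin 1 ⊕ Fin m₂) i)) := by
      intro r s c d x
      funext i
      refine Fin.lastCases (by simp) (fun i => ?_) i
      simp only [Fin.snoc_castSucc]
    have right : ∀ {r s : FinPerm} (c : Fin m₁ → Fin r.1) (d : Fin m₂ → Fin s.1) (x : Fin s.1),
        (Fin.snoc (fun i => glueEmb r s (Sum.map c (Sum.map id d) (f i)))
            (glueEmb r s (.inr (.inr x))) : Fin (m + 1) → Fin (glue r s).1) =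
          fun i => glueEmb r s
            (Sum.map c (Sum.map id (Fin.snoc d x : Fin (m₂ + 1) → Fin s.1))
              ((Fin.snoc (fun i => Sum.map id (Sum.map id Fin.castSucc) (f i))
                (.inr (.inr (Fin.last m₂))) :
                Fin (m + 1) → Fin m₁ ⊕ Fin 1 ⊕ Fin (m₂ + 1)) i)) := by
      intro r s c d x
      funext i
      refine Fin.lastCases (by simp) (fun i => ?_) i
      simp only [Fin.snoc_castSucc]
      rcases f i with y | y | y <;> simp
    refine rankType_succ_eq_iff.2 ⟨atoms_glue_eq f ha₀ hb₀, fun x => ?_, fun x => ?_⟩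
    · obtain ⟨x, rfl⟩ := glueEmb_surjective _ _ x
      rcases x with x | x | x
      · obtain ⟨y, hy⟩ := ha₁ x
        refine ⟨glueEmb p' q' (.inl y), ?_⟩
        rw [left, left]
        exact ih _ hy (rankType_eq_of_succ hb)
      · refine ⟨glueEmb p' q' (.inr (.inl x)), ?_⟩
        rw [mid, mid]
        exact ih _ (rankType_eq_of_succ ha) (rankType_eq_of_succ hb)
      · obtain ⟨y, hy⟩ := hb₁ x
        refine ⟨glueEmb p' q' (.inr (.inr y)), ?_⟩
        rw [right, right]
        exact ih _ (rankType_eq_of_succ ha) hy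
    · obtain ⟨x, rfl⟩ := glueEmb_surjective _ _ x
      rcases x with x | x | x
      · obtain ⟨y, hy⟩ := ha₂ x
        refine ⟨glueEmb p q (.inl y), ?_⟩
        rw [left, left]
        exact ih _ hy (rankType_eq_of_succ hb)
      · refine ⟨glueEmb p q (.inr (.inl x)), ?_⟩
        rw [mid, mid]
        exact ih _ (rankType_eq_of_succ ha) (rankType_eq_of_succ hb)
      · obtain ⟨y, hy⟩ := hb₂ x
        refine ⟨glueEmb p q (.inr (.inr y)), ?_⟩
        rw [right, right]
        exact ih _ (rankType_eq_of_succ ha) hy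

theorem typeOf_glue_eq {k : ℕ} {p p' q q' : FinPerm} (hp : typeOf k p = typeOf k p')
    (hq : typeOf k q = typeOf k q') : typeOf k (glue p q) = typeOf k (glue p' q') := by
  rw [typeOf_eq_iff] at *
  convert rankType_glue_eq k (m := 0) default hp hq using 2

theorem Hfun_typeOf (k : ℕ) (p q : FinPerm) :
    Hfun k (typeOf k p) (typeOf k q) = typeOf k (glue p q) :=
  typeOf_glue_eq (Quotient.out_eq _) (Quotient.out_eq _)

theorem avoidsF_glue {p q : FinPerm} : AvoidsF (glue p q) ↔ AvoidsF p ∧ AvoidsF q := by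
  constructor
  · intro h
    refine ⟨?_, ?_⟩
    · rintro ⟨i, j, l, hij, hjl, h₁, h₂⟩
      refine h ⟨glueEmb p q (.inl i), glueEmb p q (.inl j), glueEmb p q (.inl l),
        ?_, ?_, ?_, ?_⟩ <;>
        simpa only [Fin.lt_def, glueEmb_left, glue_apply_left]
    · rintro ⟨i, j, l, hij, hjl, h₁, h₂⟩
      refine h ⟨glueEmb p q (.inr (.inr i)), glueEmb p q (.inr (.inr j)),
        glueEmb p q (.inr (.inr l)), ?_, ?_, ?_, ?_⟩ <;>
        simpa only [Fin.lt_def, glueEmb_right, glue_apply_right, Nat.add_lt_add_iff_left]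
  · rintro ⟨hp, hq⟩ ⟨i, j, l, hij, hjl, h₁, h₂⟩
    obtain ⟨i, rfl⟩ := glueEmb_surjective _ _ i
    obtain ⟨j, rfl⟩ := glueEmb_surjective _ _ j
    obtain ⟨l, rfl⟩ := glueEmb_surjective _ _ l
    rw [Fin.lt_def] at hij hjl h₁ h₂
    rcases i with i | i | i <;> rcases j with j | j | j <;> rcases l with l | l | l <;>
      simp only [glueEmb_left, glueEmb_mid, glueEmb_right, glue_apply_left, glue_apply_mid,
        glue_apply_right] at hij hjl h₁ h₂
    case inl.inl.inl => exact hp ⟨i, j, l, hij, hjl, h₁, h₂⟩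
    case inr.inr.inr.inr.inr.inr =>
      exact hq ⟨i, j, l, Fin.lt_def.2 (by omega), Fin.lt_def.2 (by omega),
        Fin.lt_def.2 (by omega), Fin.lt_def.2 (by omega)⟩
    all_goals omega

theorem realized_Hfun {k : ℕ} {s t : QT k} (hs : Realized k s) (ht : Realized k t) :
    Realized k (Hfun k s t) := by
  obtain ⟨p, hp, rfl⟩ := hs
  obtain ⟨q, hq, rfl⟩ := ht
  exact ⟨glue p q, avoidsF_glue.2 ⟨hp, hq⟩, (Hfun_typeOf k p q).symm⟩

/-! ### Counting `231`-avoiding permutations -/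

theorem apply_eq_of_eq {p q : FinPerm} (h : p = q) {i : Fin p.1} {j : Fin q.1}
    (hij : (i : ℕ) = j) : (p.2 i : ℕ) = q.2 j := by
  subst h
  rw [Fin.ext hij]

theorem finPerm_ext {p q : FinPerm} (h : p.1 = q.1)
    (h' : ∀ (i : Fin p.1) (j : Fin q.1), (i : ℕ) = j → (p.2 i : ℕ) = q.2 j) : p = q := by
  obtain ⟨n, σ⟩ := p
  obtain ⟨m, τ⟩ := q
  obtain rfl : n = m := h
  exact congrArg _ (Equiv.ext fun i => Fin.ext (h' i i rfl))

theorem glue_injective {p p' q q' : FinPerm} (h : glue p q = glue p' q') :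
    p = p' ∧ q = q' := by
  have hsize : p.1 + (1 + q.1) = p'.1 + (1 + q'.1) := congrArg Sigma.fst h
  have hp : p.1 = p'.1 := by
    have hmid : glueEmb p' q' (.inr (.inl 0)) = ⟨p.1, by
        change p.1 < p'.1 + (1 + q'.1); omega⟩ := by
      refine (glue p' q').2.injective (Fin.ext ?_)
      rw [glue_apply_mid, ← apply_eq_of_eq h (i := glueEmb p q (.inr (.inl 0)))
        (glueEmb_mid _ _ _), glue_apply_mid]
      omega
    have := congrArg Fin.val hmid
    rw [glueEmb_mid] at this
    exact this.symm
  refine ⟨finPerm_ext hp fun i j hij => ?_, finPerm_ext (by omega) fun i j hij => ?_⟩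
  · rw [← glue_apply_left p q, ← glue_apply_left p' q']
    exact apply_eq_of_eq h hij
  · have := apply_eq_of_eq h (i := glueEmb p q (.inr (.inr i)))
      (j := glueEmb p' q' (.inr (.inr j))) (by rw [glueEmb_right, glueEmb_right]; omega)
    rw [glue_apply_right, glue_apply_right] at this
    omega

theorem exists_glue_eq {n : ℕ} (σ : Equiv.Perm (Fin (n + 1))) (hσ : Avoids σ) :
    ∃ p q : FinPerm, glue p q = ⟨n + 1, σ⟩ := by
  obtain ⟨m, hm⟩ := σ.surjective (Fin.last n)
  have hmax : ∀ i, i ≠ m → σ i < σ m := fun i hi =>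
    hm ▸ Fin.lt_last_iff_ne_last.2 fun h => hi (σ.injective (h.trans hm.symm))
  have hsep : ∀ i j, i < m → m < j → σ i < σ j := by
    intro i j hi hj
    by_contra hlt
    have hne : σ j ≠ σ i := fun h => (hi.trans hj).ne' (σ.injective h)
    exact hσ ⟨i, m, j, hi, hj, lt_of_le_of_ne (not_lt.1 hlt) hne, hmax i hi.ne⟩
  have hleft : ∀ i, i < m → (σ i : ℕ) < m := by
    intro i hi
    have : (Finset.Iic (σ i)).card ≤ (Finset.Iio m).card := by
      refine Finset.card_le_card_of_injOn σ.symm (fun v hv => ?_) σ.symm.injective.injOn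
      obtain ⟨j, rfl⟩ := σ.surjective v
      simp only [Finset.coe_Iic, Set.mem_Iic, Finset.coe_Iio, Set.mem_Iio,
        Equiv.symm_apply_apply] at hv ⊢
      rcases lt_trichotomy j m with hj | rfl | hj
      · exact hj
      · exact absurd (hmax i hi.ne) (not_lt.2 hv)
      · exact absurd (hsep i j hi hj) (not_lt.2 hv)
    rw [Fin.card_Iic, Fin.card_Iio] at this
    omega
  have hright : ∀ j, m < j → (m : ℕ) ≤ σ j := by
    intro j hj
    have : (Finset.Iio m).card ≤ (Finset.Iio (σ j)).card := by
      refine Finset.card_le_card_of_injOn σ (fun i hi => ?_) σ.injective.injOn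
      simp only [Finset.coe_Iio, Set.mem_Iio] at hi ⊢
      exact hsep i j hi hj
    rwa [Fin.card_Iio, Fin.card_Iio] at this
  have hm' := m.isLt
  let α : Fin m → Fin m := fun i => ⟨σ ⟨i, by omega⟩, hleft _ i.isLt⟩
  have hα : Function.Injective α := fun i j h => by
    have h := Fin.ext_iff.1 h
    simp only [α] at h
    have h := Fin.ext_iff.1 (σ.injective (Fin.ext h))
    exact Fin.ext h
  have hpos : ∀ j : Fin (n - m), m < (⟨m + (1 + j), by omega⟩ : Fin (n + 1)) := fun j =>
    Fin.lt_def.2 (by change (m : ℕ) < m + (1 + j); omega)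
  let β : Fin (n - m) → Fin (n - m) := fun j => ⟨σ ⟨m + (1 + j), by omega⟩ - m, by
    have h₁ := hright _ (hpos j)
    have h₂ := Fin.lt_def.1 (hmax _ (hpos j).ne')
    rw [hm, Fin.val_last] at h₂
    omega⟩
  have hβ : Function.Injective β := fun i j h => by
    have h₁ := hright _ (hpos i)
    have h₂ := hright _ (hpos j)
    have h₃ := Fin.ext_iff.1 h
    simp only [β] at h₃
    have := Fin.ext_iff.1 (σ.injective (Fin.ext (by omega :
      (σ ⟨m + (1 + i), _⟩ : ℕ) = σ ⟨m + (1 + j), _⟩)))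
    simp only at this
    exact Fin.ext (by omega)
  refine ⟨⟨m, Equiv.ofBijective α (Finite.injective_iff_bijective.1 hα)⟩,
    ⟨n - m, Equiv.ofBijective β (Finite.injective_iff_bijective.1 hβ)⟩,
    finPerm_ext (by change (m : ℕ) + (1 + (n - m)) = n + 1; omega) fun i j hij => ?_⟩
  obtain ⟨i, rfl⟩ := glueEmb_surjective _ _ i
  rcases i with i | i | i
  · rw [glue_apply_left]
    rw [glueEmb_left] at hij
    exact congrArg (fun x => (σ x : ℕ)) (Fin.ext hij)
  · rw [glue_apply_mid]
    rw [glueEmb_mid] at hij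
    obtain rfl : m = j := Fin.ext hij
    change (m : ℕ) + (n - m) = σ m
    rw [hm, Fin.val_last]
    omega
  · rw [glue_apply_right]
    rw [glueEmb_right] at hij
    change (m : ℕ) + (σ ⟨m + (1 + i), _⟩ - m) = σ j
    have h₁ := hright _ (hpos i)
    rw [Nat.add_sub_cancel' h₁]
    exact congrArg (fun x => (σ x : ℕ)) (Fin.ext hij)

/-- The permutation coded by a binary tree. -/
def treePerm : BinaryTree Unit → FinPerm
  | .nil => ⟨0, 1⟩
  | .node _ l r => glue (treePerm l) (treePerm r)

theorem treePerm_fst (T : BinaryTree Unit) : (treePerm T).1 = T.numNodes := by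
  induction T with
  | nil => rfl
  | node _ l r hl hr =>
    change (treePerm l).1 + (1 + (treePerm r).1) = l.numNodes + r.numNodes + 1
    omega

theorem avoidsF_treePerm (T : BinaryTree Unit) : AvoidsF (treePerm T) := by
  induction T with
  | nil => rintro ⟨i, -⟩; exact i.elim0
  | node _ l r hl hr => exact avoidsF_glue.2 ⟨hl, hr⟩

theorem treePerm_injective : Function.Injective treePerm := by
  intro T
  induction T with
  | nil =>
    rintro (_ | ⟨_, l, r⟩) h
    · rfl
    · have : 0 = (treePerm l).1 + (1 + (treePerm r).1) := congrArg Sigma.fst h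
      omega
  | node _ l r hl hr =>
    rintro (_ | ⟨_, l', r'⟩) h
    · have : (treePerm l).1 + (1 + (treePerm r).1) = 0 := congrArg Sigma.fst h
      omega
    · obtain ⟨h₁, h₂⟩ := glue_injective h
      rw [hl h₁, hr h₂]

theorem exists_treePerm_eq (n : ℕ) : ∀ p : FinPerm, p.1 = n → AvoidsF p →
    ∃ T, treePerm T = p := by
  induction n using Nat.strong_induction_on with
  | _ n ih =>
    rintro ⟨m, σ⟩ hm hσ
    obtain rfl : m = n := hm
    obtain _ | m := m
    · exact ⟨.nil, finPerm_ext rfl fun i => i.elim0⟩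
    · obtain ⟨p, q, h⟩ := exists_glue_eq σ hσ
      have hsize : p.1 + (1 + q.1) = m + 1 := congrArg Sigma.fst h
      rw [← h, avoidsF_glue] at hσ
      obtain ⟨l, hl⟩ := ih p.1 (by omega) p rfl hσ.1
      obtain ⟨r, hr⟩ := ih q.1 (by omega) q rfl hσ.2
      exact ⟨.node () l r, by rw [← h, ← hl, ← hr]; rfl⟩

theorem card_avoids (n : ℕ) : Nat.card {σ : Equiv.Perm (Fin n) // Avoids σ} = catalan n := by
  rw [← BinaryTree.treesOfNumNodesEq_card_eq_catalan, ← Nat.card_eq_finsetCard]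
  let e : {σ : Equiv.Perm (Fin n) // Avoids σ} → BinaryTree.treesOfNumNodesEq n := fun σ =>
    ⟨(exists_treePerm_eq n ⟨n, σ.1⟩ rfl σ.2).choose, by
      rw [BinaryTree.mem_treesOfNumNodesEq, ← treePerm_fst,
        (exists_treePerm_eq n ⟨n, σ.1⟩ rfl σ.2).choose_spec]⟩
  have he : ∀ σ, treePerm (e σ).1 = ⟨n, σ.1⟩ := fun σ =>
    (exists_treePerm_eq n ⟨n, σ.1⟩ rfl σ.2).choose_spec
  refine Nat.card_congr (Equiv.ofBijective e ⟨fun σ τ h => ?_, fun T => ?_⟩)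
  · have := (he σ).symm.trans ((congrArg (fun T => treePerm T.1) h).trans (he τ))
    exact Subtype.ext (eq_of_heq (Sigma.mk.inj this).2)
  · obtain ⟨T, hT⟩ := T
    obtain rfl : T.numNodes = n := BinaryTree.mem_treesOfNumNodesEq.1 hT
    have hav := avoidsF_treePerm T
    rcases hp : treePerm T with ⟨m, σ⟩
    have hm := treePerm_fst T
    rw [hp] at hm hav
    obtain rfl : m = T.numNodes := hm
    exact ⟨⟨σ, hav⟩, Subtype.ext (treePerm_injective ((he _).trans hp.symm))⟩

/-! ### The generating series at `1/4` -/

theorem hasSum_catalan_quarter : HasSum (fun n : ℕ => (catalan n : ℝ) * (1 / 4) ^ n) 2 := by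
  set c : ℕ → ℝ := fun n => (Nat.centralBinom n : ℝ) * (1 / 4) ^ n with hc
  have hrec : ∀ n : ℕ, (n + 1) * c (n + 1) = (n + 1 / 2) * c n := by
    intro n
    have h : ((n : ℝ) + 1) * Nat.centralBinom (n + 1) = 2 * (2 * n + 1) * Nat.centralBinom n := by
      exact_mod_cast Nat.succ_mul_centralBinom_succ n
    simp only [hc, pow_succ]
    linear_combination (1 / 4) ^ n * (1 / 4) * h
  have hpos : ∀ n, 0 ≤ c n := fun n => by positivity
  have hsum : ∀ n : ℕ, ∑ i ∈ Finset.range n, (catalan i : ℝ) * (1 / 4) ^ i = 2 * (1 - c n) := by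
    intro n
    induction n with
    | zero => simp [hc]
    | succ n ih =>
      have h : ((n : ℝ) + 1) * catalan n = Nat.centralBinom n := by
        exact_mod_cast succ_mul_catalan_eq_centralBinom n
      rw [Finset.sum_range_succ, ih]
      have hn : (n : ℝ) + 1 ≠ 0 := by positivity
      refine mul_left_cancel₀ hn ?_
      have hcn : c n = (Nat.centralBinom n : ℝ) * (1 / 4) ^ n := rfl
      linear_combination 2 * hrec n + (1 / 4) ^ n * h - hcn
  have hbound : ∀ n : ℕ, c n ^ 2 ≤ 1 / (n + 1) := by
    intro n
    induction n with
    | zero => simp [hc]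
    | succ n ih =>
      have hn : (0 : ℝ) < n + 1 := by positivity
      have h₁ : c (n + 1) = (n + 1 / 2) * c n / (n + 1) := by
        rw [eq_div_iff hn.ne', ← hrec]; ring
      rw [h₁, div_pow, mul_pow, div_le_div_iff₀ (by positivity) (by positivity)]
      rw [le_div_iff₀ hn] at ih
      push_cast
      have h₂ : ((n : ℝ) + 1 / 2) ^ 2 * (n + 1 + 1) ≤ (n + 1) ^ 3 := by
        have : (0 : ℝ) ≤ n := n.cast_nonneg
        nlinarith
      have h₃ := mul_le_mul_of_nonneg_left h₂ (sq_nonneg (c n))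
      nlinarith [mul_le_mul_of_nonneg_left ih (sq_nonneg ((n : ℝ) + 1))]
  have hlim : Tendsto c atTop (𝓝 0) := by
    have h : Tendsto (fun n => c n ^ 2) atTop (𝓝 0) :=
      squeeze_zero (fun n => sq_nonneg _) hbound tendsto_one_div_add_atTop_nhds_zero_nat
    have h' := h.sqrt
    simpa [Real.sqrt_sq (hpos _)] using h'
  rw [hasSum_iff_tendsto_nat_of_nonneg (fun n => by positivity)]
  simp only [hsum]
  simpa using (hlim.const_sub 1).const_mul 2

/-- The value `C_t(1/4)` as a real number. -/
noncomputable def weight (k : ℕ) (t : QT k) : ℝ := ∑' n : ℕ, (cnt k t n : ℝ) * (1 / 4) ^ n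

theorem Ct_quarter (k : ℕ) (t : QT k) : Ct k t (1 / 4) = weight k t := by
  simp only [Ct, weight, Complex.ofReal_tsum]
  push_cast
  rfl

theorem cnt_le_catalan (k : ℕ) (t : QT k) (n : ℕ) : cnt k t n ≤ catalan n := by
  rw [← card_avoids]
  exact Nat.card_le_card_of_injective
    (fun σ => (⟨σ.1, σ.2.1⟩ : {σ : Equiv.Perm (Fin n) // Avoids σ}))
    fun σ τ h => Subtype.ext (congrArg (fun x => x.1) h)

theorem sum_cnt (k : ℕ) [Fintype (Tk k)] (n : ℕ) : ∑ t : Tk k, cnt k t.1 n = catalan n := by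
  rw [← card_avoids]
  simp only [cnt]
  rw [← Nat.card_sigma]
  exact Nat.card_congr
    { toFun := fun x => ⟨x.2.1, x.2.2.1⟩
      invFun := fun σ => ⟨⟨typeOf k ⟨n, σ.1⟩, ⟨n, σ.1⟩, σ.2, rfl⟩, σ.1, σ.2, rfl⟩
      left_inv := by
        rintro ⟨⟨t, _⟩, σ, _, h⟩
        obtain rfl : typeOf k ⟨n, σ⟩ = t := h
        rfl
      right_inv := fun _ => rfl }

theorem summable_cnt (k : ℕ) (t : QT k) :
    Summable fun n : ℕ => (cnt k t n : ℝ) * (1 / 4) ^ n :=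
  hasSum_catalan_quarter.summable.of_nonneg_of_le (fun n => by positivity) fun n => by
    gcongr
    exact cnt_le_catalan k t n

theorem weight_nonneg (k : ℕ) (t : QT k) : 0 ≤ weight k t := tsum_nonneg fun n => by positivity

theorem ite_weight_nonneg {k : ℕ} (P : Prop) [Decidable P] (t : QT k) :
    0 ≤ if P then weight k t else 0 := by
  split_ifs
  exacts [weight_nonneg k t, le_rfl]

theorem weight_pos {k : ℕ} {t : QT k} (ht : Realized k t) : 0 < weight k t := by
  obtain ⟨⟨n, σ⟩, hσ, hp⟩ := ht
  refine (summable_cnt k t).tsum_pos (fun n => by positivity) n ?_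
  have : Nonempty {σ : Equiv.Perm (Fin n) // Avoids σ ∧ typeOf k ⟨n, σ⟩ = t} := ⟨σ, hσ, hp⟩
  have : 0 < cnt k t n := Nat.card_pos
  positivity

theorem sum_weight (k : ℕ) [Fintype (Tk k)] : ∑ t : Tk k, weight k t.1 = 2 := by
  simp only [weight]
  rw [← Summable.tsum_finsetSum fun t _ => summable_cnt k t.1, ← hasSum_catalan_quarter.tsum_eq]
  refine tsum_congr fun n => ?_
  rw [← Finset.sum_mul, ← sum_cnt k n]
  push_cast
  rfl

/-! ### The Jacobian at `1/4` -/

open Classical in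
/-- The entries of the Jacobian at `1/4` as real numbers. -/
noncomputable def jacobian (k : ℕ) [Fintype (Tk k)] (t u : Tk k) : ℝ :=
  1 / 4 * ((∑ v : Tk k, if Hfun k u.1 v.1 = t.1 then weight k v.1 else 0) +
    ∑ v : Tk k, if Hfun k v.1 u.1 = t.1 then weight k v.1 else 0)

open Classical in
theorem tsum_realized (k : ℕ) [Fintype (Tk k)] (P : QT k → Prop) :
    ∑' v : {v : QT k // Realized k v ∧ P v}, Ct k v.1 (1 / 4) =
      ((∑ v : Tk k, if P v.1 then weight k v.1 else 0 : ℝ) : ℂ) := by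
  let e : {v : Tk k | P v.1} ≃ {v : QT k // Realized k v ∧ P v} :=
    { toFun := fun v => ⟨v.1.1, v.1.2, v.2⟩
      invFun := fun v => ⟨⟨v.1, v.2.1⟩, v.2.2⟩
      left_inv := fun _ => rfl
      right_inv := fun _ => rfl }
  refine (e.tsum_eq _).symm.trans
    ((tsum_subtype {v : Tk k | P v.1} fun v => Ct k v.1 (1 / 4)).trans ?_)
  rw [tsum_fintype]
  push_cast
  refine Finset.sum_congr rfl fun v _ => ?_
  by_cases hv : P v.1 <;> simp [hv, ← Ct_quarter]

theorem Mmat_quarter (k : ℕ) [Fintype (Tk k)] (t u : Tk k) :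
    Mmat k (1 / 4) t.1 u.1 = jacobian k t u := by
  rw [Mmat, tsum_realized, tsum_realized, jacobian]
  push_cast
  rfl

theorem jacobian_nonneg (k : ℕ) [Fintype (Tk k)] (t u : Tk k) : 0 ≤ jacobian k t u := by
  classical
  exact mul_nonneg (by norm_num)
    (add_nonneg (Finset.sum_nonneg fun v _ => ite_weight_nonneg _ v.1)
      (Finset.sum_nonneg fun v _ => ite_weight_nonneg _ v.1))

theorem edgeT_of_jacobian_ne_zero {k : ℕ} [Fintype (Tk k)] {t u : Tk k}
    (h : jacobian k t u ≠ 0) : EdgeT k u t := by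
  by_contra hne
  refine h ?_
  have h₁ : ∀ v : Tk k, Hfun k u.1 v.1 ≠ t.1 := fun v hv => hne ⟨v.1, v.2, .inl hv⟩
  have h₂ : ∀ v : Tk k, Hfun k v.1 u.1 ≠ t.1 := fun v hv => hne ⟨v.1, v.2, .inr hv⟩
  simp [jacobian, h₁, h₂]

theorem jacobian_pos_of_Hfun_eq {k : ℕ} [Fintype (Tk k)] {t u v : Tk k}
    (h : Hfun k v.1 u.1 = t.1) : 0 < jacobian k t u := by
  classical
  refine mul_pos (by norm_num) (add_pos_of_nonneg_of_pos
    (Finset.sum_nonneg fun v _ => ite_weight_nonneg _ v.1)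
    (Finset.sum_pos' (fun v _ => ite_weight_nonneg _ v.1) ⟨v, Finset.mem_univ v, ?_⟩))
  rw [if_pos h]
  exact weight_pos v.2

theorem sum_jacobian (k : ℕ) [Fintype (Tk k)] (u : Tk k) : ∑ t, jacobian k t u = 1 := by
  classical
  have h : ∀ f : Tk k → Tk k,
      ∑ t : Tk k, ∑ v : Tk k, (if (f v).1 = t.1 then weight k v.1 else 0) = 2 := by
    intro f
    rw [Finset.sum_comm, ← sum_weight k]
    refine Finset.sum_congr rfl fun v _ => ?_
    rw [Finset.sum_eq_single_of_mem (f v) (Finset.mem_univ _)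
      fun t _ ht => if_neg fun h => ht (Subtype.ext h.symm), if_pos rfl]
  have h₁ := h fun v => ⟨Hfun k u.1 v.1, realized_Hfun u.2 v.2⟩
  have h₂ := h fun v => ⟨Hfun k v.1 u.1, realized_Hfun v.2 u.2⟩
  simp only [jacobian]
  rw [← Finset.mul_sum, Finset.sum_add_distrib, h₁, h₂]
  norm_num

/-! ### Eigenvalues and column sums -/

theorem sum_support_eq {α : Type*} [Fintype α] (f : α → ℂ) (v : α →₀ ℂ) :
    ∑ y ∈ v.support, f y * v y = ∑ y, f y * v y :=
  Finset.sum_subset (Finset.subset_univ _) fun y _ hy => by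
    rw [Finsupp.notMem_support_iff.1 hy, mul_zero]

theorem norm_le_of_isEig {α : Type*} [Fintype α] {A : α → α → ℂ} {c : ℝ}
    (hA : ∀ y, ∑ x, ‖A x y‖ ≤ c) {lam : ℂ} (h : IsEig A lam) : ‖lam‖ ≤ c := by
  obtain ⟨v, hv, hev⟩ := h
  have hpos : 0 < ∑ x, ‖v x‖ := by
    obtain ⟨x, hx⟩ := Finsupp.ne_iff.1 hv
    exact Finset.sum_pos' (fun _ _ => norm_nonneg _) ⟨x, Finset.mem_univ x, norm_pos_iff.2 hx⟩
  refine le_of_mul_le_mul_right ?_ hpos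
  calc ‖lam‖ * ∑ x, ‖v x‖ = ∑ x, ‖∑ y, A x y * v y‖ := by
        rw [Finset.mul_sum]
        refine Finset.sum_congr rfl fun x _ => ?_
        rw [← sum_support_eq, hev, norm_mul]
    _ ≤ ∑ x, ∑ y, ‖A x y‖ * ‖v y‖ := Finset.sum_le_sum fun x _ =>
        (norm_sum_le _ _).trans_eq (Finset.sum_congr rfl fun y _ => norm_mul _ _)
    _ = ∑ y, (∑ x, ‖A x y‖) * ‖v y‖ := by
        rw [Finset.sum_comm]
        simp only [Finset.sum_mul]
    _ ≤ ∑ y, c * ‖v y‖ := Finset.sum_le_sum fun y _ =>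
        mul_le_mul_of_nonneg_right (hA y) (norm_nonneg _)
    _ = c * ∑ x, ‖v x‖ := (Finset.mul_sum _ _ _).symm

theorem isEig_one {α : Type*} [Fintype α] [Nonempty α] {A : α → α → ℂ}
    (hA : ∀ y, ∑ x, A x y = 1) : IsEig A 1 := by
  classical
  have hdet : (Matrix.of A - 1).det = 0 := by
    refine Matrix.exists_vecMul_eq_zero_iff.1 ⟨1, one_ne_zero, ?_⟩
    rw [Matrix.vecMul_sub, Matrix.vecMul_one, sub_eq_zero]
    funext y
    simp [Matrix.vecMul, dotProduct, hA]
  obtain ⟨v, hv, h⟩ := Matrix.exists_mulVec_eq_zero_iff.2 hdet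
  rw [Matrix.sub_mulVec, Matrix.one_mulVec, sub_eq_zero] at h
  refine ⟨Finsupp.equivFunOnFinite.symm v, fun h₀ => hv ?_, fun x => ?_⟩
  · exact funext fun x => DFunLike.congr_fun h₀ x
  · rw [sum_support_eq, one_mul]
    exact congrFun h x

/-- Spectral radii of the Jacobian at `z = 1/4`:
`SR(M_k^•(1/4)) < SR(M_k^★(1/4)) = SR(M_k(1/4)) = 1`, where `M_k^★` (resp. `M_k^•`) is the
principal submatrix indexed by the terminal strongly connected component `𝒯ₖ★`
(resp. by its complement `𝒯ₖ•`). Spectral radius conditions are expressed through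
eigenvalues: all eigenvalues of `M_k(1/4)` and `M_k^★(1/4)` have modulus at most `1` and `1`
is an eigenvalue of both, while the moduli of eigenvalues of `M_k^•(1/4)` are bounded by some
`ε < 1`. -/
theorem spectral_radii (k : ℕ) (hk : 2 ≤ k) (S : Set (Tk k)) (hS : IsTermSCC k S) :
    (∀ lam : ℂ, IsEig (fun t u : Tk k => Mmat k (1 / 4) t.1 u.1) lam → ‖lam‖ ≤ 1) ∧
    IsEig (fun t u : Tk k => Mmat k (1 / 4) t.1 u.1) 1 ∧
    (∀ lam : ℂ, IsEig (fun t u : S => Mmat k (1 / 4) t.1.1 u.1.1) lam → ‖lam‖ ≤ 1) ∧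
    IsEig (fun t u : S => Mmat k (1 / 4) t.1.1 u.1.1) 1 ∧
    (∃ ε : ℝ, ε < 1 ∧ ∀ lam : ℂ,
      IsEig (fun t u : ↥Sᶜ => Mmat k (1 / 4) t.1.1 u.1.1) lam → ‖lam‖ ≤ ε) := by
  classical
  have : Fintype (Tk k) := Fintype.ofFinite _
  obtain ⟨⟨s, hs⟩, -, hclosed⟩ := hS
  have : Nonempty (Tk k) := ⟨s⟩
  have : Nonempty S := ⟨⟨s, hs⟩⟩
  have hnorm : ∀ t u : Tk k, ‖(jacobian k t u : ℂ)‖ = jacobian k t u := fun t u =>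
    Complex.norm_of_nonneg (jacobian_nonneg k t u)
  have hcompl : ∀ u : Tk k, ∑ t : S, jacobian k t.1 u + ∑ t : ↥Sᶜ, jacobian k t.1 u = 1 := by
    intro u
    rw [← sum_jacobian k u]
    exact Fintype.sum_subtype_add_sum_subtype (· ∈ S) fun t => jacobian k t u
  have hstar : ∀ u : S, ∑ t : S, jacobian k t.1 u.1 = 1 := by
    intro u
    rw [← hcompl u.1, left_eq_add]
    refine Finset.sum_eq_zero fun t _ => ?_
    by_contra h
    exact t.2 (hclosed u.1 u.2 t.1 (edgeT_of_jacobian_ne_zero h))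
  have hdot : ∀ u : Tk k, ∑ t : ↥Sᶜ, jacobian k t.1 u < 1 := by
    intro u
    let t : Tk k := ⟨Hfun k s.1 u.1, realized_Hfun s.2 u.2⟩
    have ht : t ∈ S := hclosed s hs t ⟨u.1, u.2, .inl rfl⟩
    have : 0 < ∑ t : S, jacobian k t.1 u :=
      Finset.sum_pos' (fun t _ => jacobian_nonneg k t.1 u)
        ⟨⟨t, ht⟩, Finset.mem_univ _, jacobian_pos_of_Hfun_eq (v := s) rfl⟩
    linarith [hcompl u]
  simp only [Mmat_quarter]
  refine ⟨fun lam => norm_le_of_isEig fun u => ?_, isEig_one fun u => ?_,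
    fun lam => norm_le_of_isEig fun u => ?_, isEig_one fun u => ?_, ?_⟩
  · simp only [hnorm, sum_jacobian, le_refl]
  · exact_mod_cast sum_jacobian k u
  · simp only [hnorm, hstar, le_refl]
  · exact_mod_cast hstar u
  · obtain ⟨u₀, h₀⟩ := Finite.exists_max fun u : Tk k => ∑ t : ↥Sᶜ, jacobian k t.1 u
    refine ⟨_, hdot u₀, fun lam => norm_le_of_isEig fun u => ?_⟩
    simp only [hnorm]
    exact h₀ u.1

end Av231
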